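/- (Closed-form 2-Wasserstein distance for signatures of the standard univariate Gaussian.) Let c_1 < c_2 < … < c_N be real numbers, and let the real line be partitioned into the Voronoi intervals [l_i, u_i] with l_1 = −∞, u_N = +∞, and u_i = l_{i+1} = (c_i + c_{i+1})/2 for 1 ≤ i ≤ N−1. Let Δ_C map each z ∈ [l_i, u_i] to c_i. Then, with φ and Φ the standard normal density and cumulative distribution function, W_2^2( Δ_C#N(0,1), N(0,1) ) = Σ_{i=1}^N ∫_{l_i}^{u_i} (z − c_i)² φ(z) dz = Σ_{i=1}^N [ (1 + c_i²)(Φ(u_i) − Φ(l_i)) + (l_i − 2 c_i) φ(l_i) − (u_i − 2 c_i) φ(u_i) ], where the boundary terms are interpreted with φ(±∞) = 0, Φ(−∞) = 0, Φ(+∞) = 1, and l_1 φ(l_1) = u_N φ(u_N) = 0. -/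

import Mathlib

open MeasureTheory ProbabilityTheory
open scoped ENNReal NNReal

/-- The 2-Wasserstein distance between two Borel measures on a normed space,
as the general `ρ`-Wasserstein distance
`W_ρ(p,q) = (inf_{γ ∈ Γ(p,q)} E_{(x,y)∼γ}[‖x−y‖^ρ])^{1/ρ}`. -/
noncomputable def Wp {E : Type*} [NormedAddCommGroup E] [MeasurableSpace E]
    (ρ : ℝ) (p q : Measure E) : ENNReal :=
  (⨅ γ ∈ {γ : Measure (E × E) | γ.map Prod.fst = p ∧ γ.map Prod.snd = q},
    ∫⁻ z, (‖z.1 - z.2‖₊ : ENNReal) ^ ρ ∂γ) ^ (1/ρ)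

/-- The standard normal density `φ(z) = (2π)^{−1/2} e^{−z²/2}`. -/
noncomputable def stdGaussPDF (z : ℝ) : ℝ :=
  (Real.sqrt (2 * Real.pi))⁻¹ * Real.exp (-(z ^ 2) / 2)

/-- The standard normal cumulative distribution function `Φ`. -/
noncomputable def stdGaussCDF (z : ℝ) : ℝ :=
  ∫ t in Set.Iic z, stdGaussPDF t

/-- `φ` extended to `EReal` with the convention `φ(±∞) = 0`. -/
noncomputable def phiE (x : EReal) : ℝ :=
  if x = ⊥ then 0 else if x = ⊤ then 0 else stdGaussPDF x.toReal

/-- `Φ` extended to `EReal` with the conventions `Φ(−∞) = 0`, `Φ(+∞) = 1`. -/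
noncomputable def cdfE (x : EReal) : ℝ :=
  if x = ⊥ then 0 else if x = ⊤ then 1 else stdGaussCDF x.toReal

/-- `x ↦ x·φ(x)` extended to `EReal` with the convention `(±∞)·φ(±∞) = 0`. -/
noncomputable def xphiE (x : EReal) : ℝ :=
  if x = ⊥ then 0 else if x = ⊤ then 0 else x.toReal * stdGaussPDF x.toReal

open Filter Topology Set

lemma sgp_eq : stdGaussPDF = gaussianPDFReal 0 1 := by
  funext x; simp [stdGaussPDF, gaussianPDFReal]

lemma sgp_eq' (x : ℝ) :
    stdGaussPDF x = (Real.sqrt (2 * Real.pi))⁻¹ * Real.exp (-(1/2) * x ^ 2) := by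
  rw [stdGaussPDF]; congr 2; ring

lemma sgp_integrable : Integrable stdGaussPDF := by
  rw [sgp_eq]; exact integrable_gaussianPDFReal _ _

lemma sgp_integral : ∫ x, stdGaussPDF x = 1 := by
  rw [sgp_eq]; exact integral_gaussianPDFReal_eq_one _ one_ne_zero

lemma sgp_nonneg (x : ℝ) : 0 ≤ stdGaussPDF x := by
  unfold stdGaussPDF; positivity

lemma sgp_int (c : ℝ) : Integrable (fun z => (z - c) ^ 2 * stdGaussPDF z) := by
  have h2 := (integrable_rpow_mul_exp_neg_mul_sq (b := 1/2) (by norm_num) (s := 2) (by norm_num))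
  have h1 := (integrable_mul_exp_neg_mul_sq (b := 1/2) (by norm_num))
  have h0 := (integrable_exp_neg_mul_sq (b := 1/2) (by norm_num))
  have := ((h2.add (h1.const_mul (-2 * c))).add (h0.const_mul (c ^ 2))).const_mul
    (Real.sqrt (2 * Real.pi))⁻¹
  refine this.congr (ae_of_all _ fun x => ?_)
  simp only [sgp_eq', Pi.add_apply, Real.rpow_two]
  ring

lemma sgp_deriv (c x : ℝ) :
    HasDerivAt (fun z => -((z - 2 * c) * stdGaussPDF z))
      ((x - c) ^ 2 * stdGaussPDF x - (1 + c ^ 2) * stdGaussPDF x) x := by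
  have hp : HasDerivAt stdGaussPDF (-x * stdGaussPDF x) x := by
    have h1 : HasDerivAt (fun z : ℝ => -(z ^ 2) / 2) (-x) x := by
      have := ((hasDerivAt_pow 2 x).neg).div_const 2
      exact this.congr_deriv (by simp; ring)
    have := (h1.exp).const_mul (Real.sqrt (2 * Real.pi))⁻¹
    exact this.congr_deriv (by simp only [stdGaussPDF]; ring)
  have := ((((hasDerivAt_id x).sub_const (2 * c)).mul hp)).neg
  exact this.congr_deriv (by simp; ring)

lemma sgp_tendsto (c : ℝ) :
    Tendsto (fun z => -((z - 2 * c) * stdGaussPDF z)) (cocompact ℝ) (𝓝 0) := by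
  have h1 := tendsto_rpow_abs_mul_exp_neg_mul_sq_cocompact (a := 1/2) (by norm_num) 1
  have h0 := tendsto_rpow_abs_mul_exp_neg_mul_sq_cocompact (a := 1/2) (by norm_num) 0
  have h1' : Tendsto (fun x : ℝ => x * Real.exp (-(1/2) * x ^ 2)) (cocompact ℝ) (𝓝 0) := by
    rw [tendsto_zero_iff_abs_tendsto_zero]
    refine h1.congr fun x => ?_
    simp [abs_mul]
  have := ((h1'.const_mul (-(Real.sqrt (2 * Real.pi))⁻¹)).add
    (h0.const_mul (2 * c * (Real.sqrt (2 * Real.pi))⁻¹)))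
  simp only [mul_zero, add_zero] at this
  refine this.congr fun x => ?_
  simp only [sgp_eq', Real.rpow_zero]
  ring

lemma sgp_int' (c : ℝ) : Integrable
    (fun x => (x - c) ^ 2 * stdGaussPDF x - (1 + c ^ 2) * stdGaussPDF x) :=
  (sgp_int c).sub (sgp_integrable.const_mul _)

/-- Integral of the quadratic cost over a half line with extended endpoint. -/
lemma half_line (c : ℝ) (x : EReal) :
    ∫ z in {z : ℝ | (z : EReal) ≤ x}, (z - c) ^ 2 * stdGaussPDF z
      = (1 + c ^ 2) * cdfE x - (xphiE x - 2 * c * phiE x) := by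
  have hb := (sgp_tendsto c).mono_left atBot_le_cocompact
  have ht := (sgp_tendsto c).mono_left atTop_le_cocompact
  induction x using EReal.rec with
  | bot => simp [cdfE, xphiE, phiE]
  | top =>
    have := integral_of_hasDerivAt_of_tendsto (sgp_deriv c) (sgp_int' c) hb ht
    rw [integral_sub (sgp_int c) (sgp_integrable.const_mul _), integral_const_mul,
      sgp_integral] at this
    simp [cdfE, xphiE, phiE]
    linarith
  | coe b =>
    have := integral_Iic_of_hasDerivAt_of_tendsto' (fun y (_ : y ∈ Iic b) => sgp_deriv c y)
      (sgp_int' c).integrableOn hb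
    rw [integral_sub (sgp_int c).integrableOn (sgp_integrable.const_mul _).integrableOn,
      integral_const_mul] at this
    have hs : {z : ℝ | (z : EReal) ≤ (b : EReal)} = Iic b := by ext; simp
    rw [hs]
    simp [cdfE, xphiE, phiE, stdGaussCDF]
    linarith

lemma sing_null (x : EReal) : volume {z : ℝ | (z : EReal) = x} = 0 := by
  apply Set.Subsingleton.measure_zero
  intro a ha b hb
  simp only [mem_ofPred_eq] at ha hb
  exact EReal.coe_injective (ha.trans hb.symm)

lemma meas_le (x : EReal) : MeasurableSet {z : ℝ | (z : EReal) ≤ x} :=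
  measurableSet_le measurable_coe_real_ereal measurable_const

lemma meas_cell (l u : EReal) : MeasurableSet {z : ℝ | l ≤ (z : EReal) ∧ (z : EReal) ≤ u} :=
  (measurableSet_le measurable_const measurable_coe_real_ereal).inter (meas_le u)

lemma cell_integral (c : ℝ) {l u : EReal} (h : l ≤ u) :
    ∫ z in {z : ℝ | l ≤ (z : EReal) ∧ (z : EReal) ≤ u}, (z - c) ^ 2 * stdGaussPDF z
      = (1 + c ^ 2) * (cdfE u - cdfE l) + (xphiE l - 2 * c * phiE l)
        - (xphiE u - 2 * c * phiE u) := by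
  have hae : {z : ℝ | l ≤ (z : EReal) ∧ (z : EReal) ≤ u} =ᵐ[volume]
      ({z : ℝ | (z : EReal) ≤ u} \ {z : ℝ | (z : EReal) ≤ l} : Set ℝ) := by
    have h0 : ∀ᵐ z : ℝ, (z : EReal) ≠ l := by
      rw [ae_iff]; simpa using sing_null l
    filter_upwards [h0] with z hz
    apply propext
    change (l ≤ (z : EReal) ∧ (z : EReal) ≤ u) ↔ ((z : EReal) ≤ u ∧ ¬ (z : EReal) ≤ l)
    rw [not_le]
    exact ⟨fun ⟨a, b⟩ => ⟨b, lt_of_le_of_ne a (Ne.symm hz)⟩, fun ⟨a, b⟩ => ⟨b.le, a⟩⟩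
  have hsub : {z : ℝ | (z : EReal) ≤ l} ⊆ {z : ℝ | (z : EReal) ≤ u} :=
    fun z (hz : (z : EReal) ≤ l) => hz.trans h
  rw [setIntegral_congr_set hae, setIntegral_sdiff (meas_le l) (sgp_int c).integrableOn hsub, half_line, half_line]
  ring

lemma cell_lintegral (c : ℝ) {S : Set ℝ} (hS : MeasurableSet S) :
    ∫⁻ z in S, ENNReal.ofReal ((z - c) ^ 2) ∂(gaussianReal 0 1)
      = ENNReal.ofReal (∫ z in S, (z - c) ^ 2 * stdGaussPDF z) := by
  rw [gaussianReal_of_var_ne_zero _ one_ne_zero,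
    setLIntegral_withDensity_eq_setLIntegral_mul _ (measurable_gaussianPDF _ _)
      (by fun_prop) hS,
    ofReal_integral_eq_lintegral_ofReal (sgp_int c).integrableOn
      (ae_of_all _ fun z => mul_nonneg (sq_nonneg _) (sgp_nonneg z))]
  congr 1 with z
  rw [Pi.mul_apply, gaussianPDF, ← sgp_eq, ENNReal.ofReal_mul (sq_nonneg _), mul_comm]

lemma cost_eq (x y : ℝ) : (‖x - y‖₊ : ENNReal) ^ (2 : ℝ) = ENNReal.ofReal ((y - x) ^ 2) := by
  rw [← enorm_eq_nnnorm, Real.enorm_eq_ofReal_abs,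
    ENNReal.ofReal_rpow_of_nonneg (abs_nonneg _) (by norm_num), Real.rpow_two, sq_abs]
  congr 1; ring

/-- Closed-form squared 2-Wasserstein distance between the standard univariate
Gaussian and its signature over the Voronoi intervals `[l_i, u_i]` of the
strictly increasing locations `c_0 < … < c_N`. -/
theorem wasserstein_signature_std_gaussian
    (N : ℕ) (c : Fin (N + 1) → ℝ) (hc : StrictMono c)
    (l u : Fin (N + 1) → EReal)
    (hl0 : l 0 = ⊥) (huN : u (Fin.last N) = ⊤)
    (hu : ∀ i : Fin N, u i.castSucc = ((c i.castSucc + c i.succ) / 2 : ℝ))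
    (hlu : ∀ i : Fin N, l i.succ = ((c i.castSucc + c i.succ) / 2 : ℝ))
    (Δ : ℝ → ℝ)
    (hΔmem : ∀ z, Δ z ∈ Set.range c)
    (hΔ : ∀ (i : Fin (N + 1)) (z : ℝ),
      l i < (z : EReal) → (z : EReal) < u i → Δ z = c i) :
    Wp 2 ((gaussianReal 0 1).map Δ) (gaussianReal 0 1) ^ (2 : ℝ)
      = ENNReal.ofReal (∑ i, ∫ z in {z : ℝ | l i ≤ (z : EReal) ∧ (z : EReal) ≤ u i},
          (z - c i) ^ 2 * stdGaussPDF z) ∧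
    Wp 2 ((gaussianReal 0 1).map Δ) (gaussianReal 0 1) ^ (2 : ℝ)
      = ENNReal.ofReal (∑ i,
          ((1 + (c i) ^ 2) * (cdfE (u i) - cdfE (l i))
            + (xphiE (l i) - 2 * c i * phiE (l i))
            - (xphiE (u i) - 2 * c i * phiE (u i)))) := by
  classical
  set μ := gaussianReal 0 1 with hμ
  set S : Fin (N + 1) → Set ℝ := fun i => {z : ℝ | l i ≤ (z : EReal) ∧ (z : EReal) ≤ u i} with hS
  have hSm : ∀ i, MeasurableSet (S i) := fun i => meas_cell _ _
  have hnull : ∀ x : EReal, ∀ᵐ z : ℝ ∂μ, (z : EReal) ≠ x := fun x => by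
    have h0 : ∀ᵐ z : ℝ, (z : EReal) ≠ x := by
      rw [ae_iff]; simpa using sing_null x
    exact (gaussianReal_absolutelyContinuous 0 one_ne_zero).ae_le h0
  have hmono := hc.monotone
  -- order facts
  have hlc : ∀ i, l i ≤ (c i : EReal) := by
    intro i
    induction i using Fin.cases with
    | zero => simp [hl0]
    | succ k =>
      rw [hlu, EReal.coe_le_coe_iff]
      linarith [hc (Fin.castSucc_lt_succ (i := k))]
  have hcu : ∀ i, (c i : EReal) ≤ u i := by
    intro i
    induction i using Fin.lastCases with
    | last => simp [huN]
    | cast k =>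
      rw [hu, EReal.coe_le_coe_iff]
      linarith [hc (Fin.castSucc_lt_succ (i := k))]
  have hul : ∀ i j, i < j → u i ≤ l j := by
    intro i j hij
    induction i using Fin.lastCases with
    | last => exact absurd hij (not_lt.mpr (Fin.le_last _))
    | cast k =>
      induction j using Fin.cases with
      | zero => exact absurd hij (Fin.not_lt_zero _)
      | succ m =>
        have hkm : k ≤ m := by
          rw [Fin.castSucc_lt_succ_iff] at hij; exact hij
        rw [hu, hlu, EReal.coe_le_coe_iff]
        have h1 := hmono (Fin.castSucc_le_castSucc_iff.mpr hkm)
        have h2 := hmono (Fin.succ_le_succ_iff.mpr hkm)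
        linarith
  have hcover : (⋃ i, S i) = univ := by
    refine eq_univ_of_forall fun z => ?_
    obtain ⟨i, hi⟩ := Finite.exists_min (fun j => (z - c j) ^ 2)
    refine mem_iUnion.mpr ⟨i, ?_, ?_⟩
    · induction i using Fin.cases with
      | zero => simp [hl0]
      | succ k =>
        rw [hlu, EReal.coe_le_coe_iff]
        have h1 := hc (Fin.castSucc_lt_succ (i := k))
        have h2 := hi k.castSucc
        nlinarith
    · induction i using Fin.lastCases with
      | last => simp [huN]
      | cast k =>
        rw [hu, EReal.coe_le_coe_iff]
        have h1 := hc (Fin.castSucc_lt_succ (i := k))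
        have h2 := hi k.succ
        nlinarith
  have hmin : ∀ i, ∀ z ∈ S i, ∀ j, (z - c i) ^ 2 ≤ (z - c j) ^ 2 := by
    rintro i z ⟨hz1, hz2⟩ j
    rcases lt_trichotomy j i with hij | hij | hij
    · induction i using Fin.cases with
      | zero => exact absurd hij (Fin.not_lt_zero _)
      | succ k =>
        rw [hlu, EReal.coe_le_coe_iff] at hz1
        have h1 := hc hij
        have h2 := hmono (Fin.le_castSucc_iff.mpr hij)
        nlinarith
    · rw [hij]
    · induction i using Fin.lastCases with
      | last => exact absurd hij (not_lt.mpr (Fin.le_last _))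
      | cast k =>
        rw [hu, EReal.coe_le_coe_iff] at hz2
        have h1 := hc hij
        have h2 : c k.succ ≤ c j := hmono (Fin.castSucc_lt_iff_succ_le.mp hij)
        nlinarith
  -- the minimal cost
  set m : ℝ → ENNReal := fun z => ⨅ j, ENNReal.ofReal ((z - c j) ^ 2) with hm
  have hmm : Measurable m := Measurable.iInf fun j => by fun_prop
  have hmS : ∀ i, ∀ z ∈ S i, m z = ENNReal.ofReal ((z - c i) ^ 2) := fun i z hz =>
    le_antisymm (iInf_le _ i) (le_iInf fun j => ENNReal.ofReal_le_ofReal (hmin i z hz j))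
  have hne : ∀ᵐ z : ℝ ∂μ, ∀ i, (z : EReal) ≠ l i ∧ (z : EReal) ≠ u i := by
    rw [ae_all_iff]; intro i
    filter_upwards [hnull (l i), hnull (u i)] with z h1 h2 using ⟨h1, h2⟩
  have hΔS : ∀ᵐ z ∂μ, ∀ i, z ∈ S i → Δ z = c i := by
    filter_upwards [hne] with z hz i hi
    exact hΔ i z (lt_of_le_of_ne hi.1 (hz i).1.symm) (lt_of_le_of_ne hi.2 (hz i).2)
  have hΔm : AEMeasurable Δ μ := by
    rw [← Measure.restrict_univ (μ := μ), ← hcover, aemeasurable_iUnion_iff]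
    intro i
    refine (aemeasurable_const (b := c i)).congr ?_
    rw [EventuallyEq, ae_restrict_iff' (hSm i)]
    filter_upwards [hΔS] with z hz hi using (hz i hi).symm
  have hdisj : Pairwise (Function.onFun (AEDisjoint μ) S) := by
    have key : ∀ i j, i < j → AEDisjoint μ (S i) (S j) := by
      intro i j hij
      have h0 : μ {z : ℝ | ¬ (z : EReal) ≠ u i} = 0 := hnull (u i)
      refine measure_mono_null ?_ h0
      rintro z ⟨h1, h2⟩
      simp only [mem_ofPred_eq, not_not]
      exact le_antisymm h1.2 ((hul i j hij).trans h2.1)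
    intro i j hij
    rcases lt_or_gt_of_ne hij with h | h
    · exact key i j h
    · exact (key j i h).symm
  have hsum : ∫⁻ z, m z ∂μ = ENNReal.ofReal (∑ i, ∫ z in S i, (z - c i) ^ 2 * stdGaussPDF z) := by
    rw [← setLIntegral_univ, ← hcover,
      lintegral_iUnion₀ (fun i => (hSm i).nullMeasurableSet) hdisj, tsum_fintype,
      ENNReal.ofReal_sum_of_nonneg]
    · refine Finset.sum_congr rfl fun i _ => ?_
      rw [← cell_lintegral (c i) (hSm i)]
      exact setLIntegral_congr_fun (hSm i) (fun z hz => hmS i z hz)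
    · intro i _
      exact integral_nonneg fun z => mul_nonneg (sq_nonneg _) (sgp_nonneg z)
  have hW : Wp 2 (μ.map Δ) μ ^ (2 : ℝ) = ∫⁻ z, m z ∂μ := by
    rw [Wp, ← ENNReal.rpow_mul]
    norm_num
    simp only [← enorm_eq_nnnorm]
    apply le_antisymm
    · have hp : AEMeasurable (fun z => (Δ z, z)) μ := hΔm.prodMk aemeasurable_id
      have hf : (μ.map (fun z => (Δ z, z))).map Prod.fst = μ.map Δ := by
        rw [AEMeasurable.map_map_of_aemeasurable measurable_fst.aemeasurable hp]; rfl
      have hs : (μ.map (fun z => (Δ z, z))).map Prod.snd = μ := by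
        rw [AEMeasurable.map_map_of_aemeasurable measurable_snd.aemeasurable hp]
        exact Measure.map_id
      refine (iInf₂_le (μ.map (fun z => (Δ z, z))) ⟨hf, hs⟩).trans ?_
      · rw [lintegral_map' (by fun_prop) hp]
        refine le_of_eq (lintegral_congr_ae ?_)
        filter_upwards [hΔS] with z hz
        obtain ⟨i, hi⟩ := mem_iUnion.mp (hcover ▸ mem_univ z : z ∈ ⋃ i, S i)
        rw [hmS i z hi]
        simp only [hz i hi]
        have := cost_eq (c i) z
        rw [← enorm_eq_nnnorm] at this
        exact_mod_cast this
    · refine le_iInf₂ fun γ hγ => ?_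
      obtain ⟨h1, h2⟩ := hγ
      have hr : ∀ᵐ x ∂(μ.map Δ), x ∈ range c := by
        have hms : MeasurableSet (range c) := (finite_range c).measurableSet
        exact (ae_map_iff (p := fun x => x ∈ range c) hΔm hms).mpr (ae_of_all _ hΔmem)
      rw [← h1] at hr
      have hr' := ae_of_ae_map measurable_fst.aemeasurable hr
      nth_rewrite 1 [← h2]
      rw [lintegral_map hmm measurable_snd]
      refine lintegral_mono_ae ?_
      filter_upwards [hr'] with z hz
      obtain ⟨j, hj⟩ := hz
      refine (iInf_le _ j).trans (le_of_eq ?_)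
      rw [hj]
      have := cost_eq z.1 z.2
      rw [← enorm_eq_nnnorm] at this
      exact_mod_cast this.symm
  have h1 := hW.trans hsum
  refine ⟨h1, h1.trans ?_⟩
  congr 1
  exact Finset.sum_congr rfl fun i _ => cell_integral (c i) ((hlc i).trans (hcu i))
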